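/- Let G and H be games over a poset A that both have parity. If G ≤_c H in the contextual order, then G ≤ H in the intrinsic order. -/

import Mathlib

/-- Games over a poset `α`: atomic games `[a]` for `a : α`, and composite games
`⟨L|R⟩` given by nonempty families of left and right options. -/
inductive Game (α : Type) : Type 1 where
  | atom : α → Game α
  | comp : (ι κ : Type) → (ι → Game α) → (κ → Game α) → Nonempty ι → Nonempty κ → Game α

namespace Game

variable {α β : Type}

/-- `G'` is a left option of the game. -/
def IsLeftOption (G' : Game α) : Game α → Prop
  | atom _ => False
  | comp _ _ L _ _ _ => ∃ i, L i = G'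

/-- `G'` is a right option of the game. -/
def IsRightOption (G' : Game α) : Game α → Prop
  | atom _ => False
  | comp _ _ _ R _ _ => ∃ k, R k = G'

/-- `G'` is an option of `G`. -/
def IsOption (G' G : Game α) : Prop := IsLeftOption G' G ∨ IsRightOption G' G

/-- A game is composite if it is not atomic. -/
def IsComposite : Game α → Prop
  | atom _ => False
  | comp _ _ _ _ _ _ => True

/-- `G'` is a follower of `G`: `G` itself, an option of `G`, or recursively a follower
of an option of `G`. -/
def IsFollower (G' G : Game α) : Prop := Relation.ReflTransGen IsOption G' G

/-- The dual game: Left and Right switch sides; it is a game over the opposite poset. -/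
def dual : Game α → Game αᵒᵈ
  | atom a => atom (OrderDual.toDual a)
  | comp ι κ L R hι hκ => comp κ ι (fun k => (R k).dual) (fun i => (L i).dual) hκ hι

/-- The image of a game under a (monotone) function applied to atoms. -/
def map (f : α → β) : Game α → Game β
  | atom a => atom (f a)
  | comp ι κ L R hι hκ => comp ι κ (fun i => (L i).map f) (fun k => (R k).map f) hι hκ

/-- The (disjunctive) sum of a game over `α` and a game over `β`, a game over `α × β`. -/
noncomputable def add : Game α → Game β → Game (α × β) := by
  intro G
  induction G with
  | atom g =>
    intro H
    induction H with
    | atom h => exact atom (g, h)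
    | comp ι κ L R hι hκ IHL IHR => exact comp ι κ IHL IHR hι hκ
  | comp ι κ L R hι hκ IHL IHR =>
    intro H
    induction H with
    | atom h => exact comp ι κ (fun i => IHL i (atom h)) (fun k => IHR k (atom h)) hι hκ
    | comp ι' κ' L' R' hι' hκ' IHL' IHR' =>
      exact comp (ι ⊕ ι') (κ ⊕ κ')
        (Sum.elim (fun i => IHL i (comp ι' κ' L' R' hι' hκ')) IHL')
        (Sum.elim (fun k => IHR k (comp ι' κ' L' R' hι' hκ')) IHR')
        (hι.elim fun i => ⟨Sum.inl i⟩) (hκ.elim fun k => ⟨Sum.inl k⟩)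

mutual
/-- Left has a first player winning strategy in a game over the boolean poset:
either the game is the atom `⊤`, or some left option has a second player
winning strategy for Left. -/
inductive LeftWinsFirst : Game Bool → Prop where
  | atom_top : LeftWinsFirst (atom true)
  | move {G G' : Game Bool} : IsLeftOption G' G → LeftWinsSecond G' → LeftWinsFirst G

/-- Left has a second player winning strategy in a game over the boolean poset:
every right option has a first player winning strategy for Left, and if the game
is atomic it is the atom `⊤`. -/
inductive LeftWinsSecond : Game Bool → Prop where
  | mk {G : Game Bool} : (∀ G', IsRightOption G' G → LeftWinsFirst G') →
      (∀ b, G = atom b → b = true) → LeftWinsSecond G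
end

mutual
/-- A game is even if all of its options are odd (atomic games are even). -/
inductive Even {α : Type} : Game α → Prop where
  | mk {G : Game α} : (∀ G', IsOption G' G → Odd G') → Even G

/-- A game is odd if it is composite and all of its options are even. -/
inductive Odd {α : Type} : Game α → Prop where
  | mk {G : Game α} : G.IsComposite → (∀ G', IsOption G' G → Even G') → Odd G
end

/-- A game has parity if it is even or odd. -/
def HasParity (G : Game α) : Prop := Even G ∨ Odd G

/-- `G` and `H` have matching parity (both even or both odd). -/
def MatchingParity (G H : Game α) : Prop := (Even G ∧ Even H) ∨ (Odd G ∧ Odd H)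

/-- `G` and `H` have mismatching parity (one even, the other odd). -/
def MismatchParity (G H : Game α) : Prop := (Even G ∧ Odd H) ∨ (Odd G ∧ Even H)

mutual
/-- The intrinsic order `G ≤ H` on games over a poset: every left option `G^L` of `G`
satisfies `G^L ◁ H`, every right option `H^R` of `H` satisfies `G ◁ H^R`, and if
both games are atoms `[g]`, `[h]` then `g ≤ h`. -/
inductive Le {α : Type} [PartialOrder α] : Game α → Game α → Prop where
  | mk {G H : Game α} :
      (∀ G', IsLeftOption G' G → Tri G' H) →
      (∀ H', IsRightOption H' H → Tri G H') →
      (∀ g h, G = atom g → H = atom h → g ≤ h) →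
      Le G H

/-- The intrinsic relation `G ◁ H` on games over a poset: some right option `G^R` of `G`
satisfies `G^R ≤ H`, or some left option `H^L` of `H` satisfies `G ≤ H^L`. -/
inductive Tri {α : Type} [PartialOrder α] : Game α → Game α → Prop where
  | inr {G H G' : Game α} : IsRightOption G' G → Le G' H → Tri G H
  | inl {G H H' : Game α} : IsLeftOption H' H → Le G H' → Tri G H
end

/-- The comparison game `λ(Gᵒᵖ + H)`, a game over the boolean poset, where
`λ : αᵒᵈ × α → 𝔹` is the monotone map with `λ(xᵒᵖ, y) = ⊤` iff `x ≤ y`. -/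
noncomputable def comparison [PartialOrder α] (G H : Game α) : Game Bool :=
  map (fun p : αᵒᵈ × α => @decide (OrderDual.ofDual p.1 ≤ p.2) (Classical.propDecidable _))
    (G.dual.add H)

/-- A game is locally premotive if Left has a first player winning strategy in
the comparison game `λ(Gᵒᵖ + G)`. -/
def LocallyPremotive [PartialOrder α] (G : Game α) : Prop := LeftWinsFirst (comparison G G)

/-- A game is premotive if it and all of its followers are locally premotive. -/
def Premotive [PartialOrder α] (G : Game α) : Prop :=
  ∀ G', IsFollower G' G → LocallyPremotive G'

/-- The game `* = ⟨0|0⟩` over the one-element poset. -/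
def star : Game Unit := comp Unit Unit (fun _ => atom ()) (fun _ => atom ()) ⟨()⟩ ⟨()⟩

/-- `G + *`, identified with a game over `α` via the isomorphism `α × 1 ≅ α`. -/
noncomputable def addStar (G : Game α) : Game α := map Prod.fst (G.add star)

/-- A game is locally `*`-antimonotone if `G^L + * ≤ G ≤ G^R + *` for all left and
right options `G^L`, `G^R`. -/
def LocallyStarAnti [PartialOrder α] (G : Game α) : Prop :=
  (∀ G', IsLeftOption G' G → Le G'.addStar G) ∧ (∀ G', IsRightOption G' G → Le G G'.addStar)

/-- A game is `*`-antimonotone if it and all of its followers are locally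
`*`-antimonotone. -/
def StarAnti [PartialOrder α] (G : Game α) : Prop :=
  ∀ G', IsFollower G' G → LocallyStarAnti G'

/-- `ε(G + X)`: the game `G` over `α` embedded in a context `X`, a game over the poset
`[α, 𝔹]` of monotone functions `α → 𝔹`, via the application map `ε(a, f) = f a`. -/
noncomputable def ctxSum [PartialOrder α] (G : Game α) (X : Game (α →o Bool)) : Game Bool :=
  map (fun p : α × (α →o Bool) => p.2 p.1) (G.add X)

/-- The outcome `(o_L(G), o_R(G)) ∈ 𝔹 × 𝔹` of a game over the boolean poset:
`o_L(G) = ⊤` iff Left has a first player winning strategy and `o_R(G) = ⊤` iff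
Left has a second player winning strategy. -/
noncomputable def outcome (G : Game Bool) : Bool × Bool :=
  (@decide (LeftWinsFirst G) (Classical.propDecidable _),
   @decide (LeftWinsSecond G) (Classical.propDecidable _))

/-- The contextual order `G ≤_c H`: `o(G+X) ≤ o(H+X)` for every context `X`. -/
def ContextualLe [PartialOrder α] (G H : Game α) : Prop :=
  ∀ X : Game (α →o Bool), outcome (ctxSum G X) ≤ outcome (ctxSum H X)

/-- The contextual relation `G ◁_c H`: `o_R(G+X) ≤ o_L(H+X)` for every context `X`. -/
def ContextualTri [PartialOrder α] (G H : Game α) : Prop :=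
  ∀ X : Game (α →o Bool), (outcome (ctxSum G X)).2 ≤ (outcome (ctxSum H X)).1

/-- Two games are identical when they are equal as set-based games: both are the same
atom, or both are composite with identical sets of left options and identical sets of
right options (recursively). -/
def Identical : Game α → Game α → Prop
  | atom a, atom b => a = b
  | comp _ _ L R _ _, comp _ _ L' R' _ _ =>
      ((∀ i, ∃ i', Identical (L i) (L' i')) ∧ (∀ i', ∃ i, Identical (L i) (L' i'))) ∧
      ((∀ k, ∃ k', Identical (R k) (R' k')) ∧ (∀ k', ∃ k, Identical (R k) (R' k')))
  | _, _ => False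

theorem opt_ind {P : Game α → Prop} (h : ∀ G, (∀ G', IsOption G' G → P G') → P G) :
    ∀ G, P G := by
  intro G
  induction G with
  | atom a => exact h _ (fun G' hG => by rcases hG with hG | hG <;> exact hG.elim)
  | comp ι κ L R hι hκ IHL IHR =>
    refine h _ (fun G' hG => ?_)
    rcases hG with ⟨i, rfl⟩ | ⟨i, rfl⟩
    · exact IHL i
    · exact IHR i

theorem left_ctxSum [PartialOrder α] (G : Game α) (X : Game (α →o Bool)) (K : Game Bool) :
    IsLeftOption K (ctxSum G X) ↔ (∃ G', IsLeftOption G' G ∧ ctxSum G' X = K) ∨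
      (∃ X', IsLeftOption X' X ∧ ctxSum G X' = K) := by
  cases G with
  | atom a =>
    cases X with
    | atom f => simp [ctxSum, add, map, IsLeftOption]
    | comp ι κ L R hι hκ =>
      constructor
      · rintro ⟨i, rfl⟩
        exact Or.inr ⟨_, ⟨i, rfl⟩, rfl⟩
      · rintro (⟨G', h, _⟩ | ⟨X', ⟨i, rfl⟩, rfl⟩)
        · exact h.elim
        · exact ⟨i, rfl⟩
  | comp ι κ L R hι hκ =>
    cases X with
    | atom f =>
      constructor
      · rintro ⟨i, rfl⟩
        exact Or.inl ⟨_, ⟨i, rfl⟩, rfl⟩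
      · rintro (⟨X', ⟨i, rfl⟩, rfl⟩ | ⟨G', h, _⟩)
        · exact ⟨i, rfl⟩
        · exact h.elim
    | comp ι' κ' L' R' hι' hκ' =>
      constructor
      · rintro ⟨i | i, rfl⟩
        · exact Or.inl ⟨_, ⟨i, rfl⟩, rfl⟩
        · exact Or.inr ⟨_, ⟨i, rfl⟩, rfl⟩
      · rintro (⟨X', ⟨i, rfl⟩, rfl⟩ | ⟨X', ⟨i, rfl⟩, rfl⟩)
        · exact ⟨Sum.inl i, rfl⟩
        · exact ⟨Sum.inr i, rfl⟩

theorem right_ctxSum [PartialOrder α] (G : Game α) (X : Game (α →o Bool)) (K : Game Bool) :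
    IsRightOption K (ctxSum G X) ↔ (∃ G', IsRightOption G' G ∧ ctxSum G' X = K) ∨
      (∃ X', IsRightOption X' X ∧ ctxSum G X' = K) := by
  cases G with
  | atom a =>
    cases X with
    | atom f => simp [ctxSum, add, map, IsRightOption]
    | comp ι κ L R hι hκ =>
      constructor
      · rintro ⟨i, rfl⟩
        exact Or.inr ⟨_, ⟨i, rfl⟩, rfl⟩
      · rintro (⟨G', h, _⟩ | ⟨X', ⟨i, rfl⟩, rfl⟩)
        · exact h.elim
        · exact ⟨i, rfl⟩
  | comp ι κ L R hι hκ =>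
    cases X with
    | atom f =>
      constructor
      · rintro ⟨i, rfl⟩
        exact Or.inl ⟨_, ⟨i, rfl⟩, rfl⟩
      · rintro (⟨X', ⟨i, rfl⟩, rfl⟩ | ⟨G', h, _⟩)
        · exact ⟨i, rfl⟩
        · exact h.elim
    | comp ι' κ' L' R' hι' hκ' =>
      constructor
      · rintro ⟨i | i, rfl⟩
        · exact Or.inl ⟨_, ⟨i, rfl⟩, rfl⟩
        · exact Or.inr ⟨_, ⟨i, rfl⟩, rfl⟩
      · rintro (⟨X', ⟨i, rfl⟩, rfl⟩ | ⟨X', ⟨i, rfl⟩, rfl⟩)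
        · exact ⟨Sum.inl i, rfl⟩
        · exact ⟨Sum.inr i, rfl⟩

theorem ctxSum_atom [PartialOrder α] (a : α) (f : α →o Bool) :
    ctxSum (atom a) (atom f) = atom (f a) := rfl

theorem ctxSum_eq_atom [PartialOrder α] (G : Game α) (X : Game (α →o Bool)) (b : Bool)
    (h : ctxSum G X = atom b) : ∃ a f, G = atom a ∧ X = atom f ∧ f a = b := by
  cases G with
  | atom a =>
    cases X with
    | atom f =>
      rw [ctxSum_atom] at h
      exact ⟨a, f, rfl, rfl, by injection h⟩
    | comp ι κ L R hι hκ => cases h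
  | comp ι κ L R hι hκ =>
    cases X with
    | atom f => cases h
    | comp ι' κ' L' R' hι' hκ' => cases h

/-- The monotone function `x ≤ ·`. -/
noncomputable def upper [PartialOrder α] (x : α) : α →o Bool where
  toFun y := @decide (x ≤ y) (Classical.propDecidable _)
  monotone' := by
    intro a b hab
    classical
    by_cases h : x ≤ a
    · simp [h, h.trans hab]
    · simp [h]

theorem upper_eq_true [PartialOrder α] (x y : α) : upper x y = true ↔ x ≤ y := by
  exact @decide_eq_true_iff _ (Classical.propDecidable _)

/-- The dual of `G`, as a context. -/
noncomputable def rep [PartialOrder α] : Game α → Game (α →o Bool)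
  | atom a => atom (upper a)
  | comp ι κ L R hι hκ => comp κ ι (fun k => rep (R k)) (fun i => rep (L i)) hκ hι

theorem left_rep [PartialOrder α] (G : Game α) (X : Game (α →o Bool)) :
    IsLeftOption X (rep G) ↔ ∃ G', IsRightOption G' G ∧ rep G' = X := by
  cases G <;> simp [rep, IsLeftOption, IsRightOption]

theorem right_rep [PartialOrder α] (G : Game α) (X : Game (α →o Bool)) :
    IsRightOption X (rep G) ↔ ∃ G', IsLeftOption G' G ∧ rep G' = X := by
  cases G <;> simp [rep, IsLeftOption, IsRightOption]

theorem rep_eq_atom [PartialOrder α] (G : Game α) (f : α →o Bool) (h : rep G = atom f) :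
    ∃ a, G = atom a ∧ f = upper a := by
  cases G with
  | atom a =>
    simp only [rep] at h
    injection h with h
    exact ⟨a, rfl, h.symm⟩
  | comp => simp [rep] at h

theorem wins_self [PartialOrder α] : ∀ G : Game α, LeftWinsSecond (ctxSum G (rep G)) := by
  apply opt_ind
  intro G ih
  refine ⟨?_, ?_⟩
  · intro K hK
    rcases (right_ctxSum _ _ _).1 hK with ⟨G', hG', rfl⟩ | ⟨X', hX', rfl⟩
    · exact .move ((left_ctxSum _ _ _).2 (Or.inr ⟨_, (left_rep _ _).2 ⟨G', hG', rfl⟩, rfl⟩))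
        (ih _ (Or.inr hG'))
    · obtain ⟨G', hG', rfl⟩ := (right_rep _ _).1 hX'
      exact .move ((left_ctxSum _ _ _).2 (Or.inl ⟨_, hG', rfl⟩)) (ih _ (Or.inl hG'))
  · intro b hb
    obtain ⟨a, f, rfl, h2, rfl⟩ := ctxSum_eq_atom _ _ _ hb
    simp only [rep] at h2
    injection h2 with h2
    subst h2
    exact (upper_eq_true _ _).2 le_rfl

theorem even_opt {G G' : Game α} (h : Even G) (h' : IsOption G' G) : Odd G' := by
  cases h with
  | mk h => exact h _ h'

theorem odd_opt {G G' : Game α} (h : Odd G) (h' : IsOption G' G) : Even G' := by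
  cases h with
  | mk _ h => exact h _ h'

theorem odd_comp {G : Game α} (h : Odd G) : G.IsComposite := by
  cases h with
  | mk h _ => exact h

theorem wins_imp [PartialOrder α] : ∀ G H : Game α,
    (MatchingParity G H → LeftWinsSecond (ctxSum H (rep G)) → Le G H) ∧
    (MismatchParity G H → LeftWinsFirst (ctxSum H (rep G)) → Tri G H) := by
  apply opt_ind
  intro G ihG
  apply opt_ind
  intro H ihH
  constructor
  · rintro hp ⟨hw, ha⟩
    refine ⟨?_, ?_, ?_⟩
    · intro G' hG'
      refine (ihG G' (Or.inl hG') H).2 ?_ (hw _ ((right_ctxSum _ _ _).2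
        (Or.inr ⟨_, (right_rep _ _).2 ⟨_, hG', rfl⟩, rfl⟩)))
      rcases hp with ⟨h1, h2⟩ | ⟨h1, h2⟩
      · exact Or.inr ⟨even_opt h1 (Or.inl hG'), h2⟩
      · exact Or.inl ⟨odd_opt h1 (Or.inl hG'), h2⟩
    · intro H' hH'
      refine (ihH H' (Or.inr hH')).2 ?_ (hw _ ((right_ctxSum _ _ _).2
        (Or.inl ⟨_, hH', rfl⟩)))
      rcases hp with ⟨h1, h2⟩ | ⟨h1, h2⟩
      · exact Or.inl ⟨h1, even_opt h2 (Or.inr hH')⟩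
      · exact Or.inr ⟨h1, odd_opt h2 (Or.inr hH')⟩
    · rintro g h rfl rfl
      exact (upper_eq_true _ _).1 (ha _ rfl)
  · intro hp hw
    generalize hK : ctxSum H (rep G) = K at hw
    cases hw with
    | atom_top =>
      obtain ⟨a, f, rfl, h2, -⟩ := ctxSum_eq_atom _ _ _ hK
      obtain ⟨b, rfl, -⟩ := rep_eq_atom _ _ h2
      rcases hp with ⟨h1, h2⟩ | ⟨h1, h2⟩
      · exact (odd_comp h2).elim
      · exact (odd_comp h1).elim
    | move hopt hw =>
      subst hK
      rcases (left_ctxSum _ _ _).1 hopt with ⟨H', hH', rfl⟩ | ⟨X', hX', rfl⟩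
      · refine .inl hH' ((ihH H' (Or.inl hH')).1 ?_ hw)
        rcases hp with ⟨h1, h2⟩ | ⟨h1, h2⟩
        · exact Or.inl ⟨h1, odd_opt h2 (Or.inl hH')⟩
        · exact Or.inr ⟨h1, even_opt h2 (Or.inl hH')⟩
      · obtain ⟨G', hG', rfl⟩ := (left_rep _ _).1 hX'
        refine .inr hG' ((ihG G' (Or.inr hG') H).1 ?_ hw)
        rcases hp with ⟨h1, h2⟩ | ⟨h1, h2⟩
        · exact Or.inr ⟨even_opt h1 (Or.inr hG'), h2⟩
        · exact Or.inl ⟨odd_opt h1 (Or.inr hG'), h2⟩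

theorem comp_left {G : Game α} (h : G.IsComposite) : ∃ G', IsLeftOption G' G := by
  cases G with
  | atom => exact h.elim
  | comp ι κ L R hι hκ => exact ⟨_, hι.some, rfl⟩

theorem comp_right {G : Game α} (h : G.IsComposite) : ∃ G', IsRightOption G' G := by
  cases G with
  | atom => exact h.elim
  | comp ι κ L R hι hκ => exact ⟨_, hκ.some, rfl⟩

/-- The constant monotone function. -/
def cst (α : Type) [PartialOrder α] (b : Bool) : α →o Bool := ⟨fun _ => b, fun _ _ _ => le_rfl⟩

theorem ctx_top [PartialOrder α] : ∀ G : Game α,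
    LeftWinsFirst (ctxSum G (atom (cst α true))) ∧
    LeftWinsSecond (ctxSum G (atom (cst α true))) := by
  apply opt_ind
  intro G ih
  constructor
  · cases G with
    | atom a => exact .atom_top
    | comp ι κ L R hι hκ =>
      exact .move (G' := ctxSum (L hι.some) _) ⟨hι.some, rfl⟩ (ih _ (Or.inl ⟨hι.some, rfl⟩)).2
  · refine ⟨?_, ?_⟩
    · intro K hK
      rcases (right_ctxSum _ _ _).1 hK with ⟨G', hG', rfl⟩ | ⟨X', hX', rfl⟩
      · exact (ih _ (Or.inr hG')).1
      · exact hX'.elim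
    · intro b hb
      obtain ⟨a, f, rfl, h2, rfl⟩ := ctxSum_eq_atom _ _ _ hb
      injection h2 with h2
      subst h2
      rfl

theorem ctx_bot [PartialOrder α] : ∀ G : Game α,
    ¬ LeftWinsFirst (ctxSum G (atom (cst α false))) ∧
    ¬ LeftWinsSecond (ctxSum G (atom (cst α false))) := by
  apply opt_ind
  intro G ih
  constructor
  · intro hw
    generalize hK : ctxSum G (atom (cst α false)) = K at hw
    cases hw with
    | atom_top =>
      obtain ⟨a, f, rfl, h2, h3⟩ := ctxSum_eq_atom _ _ _ hK
      injection h2 with h2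
      subst h2
      cases h3
    | move hopt hw =>
      subst hK
      rcases (left_ctxSum _ _ _).1 hopt with ⟨H', hH', rfl⟩ | ⟨X', hX', rfl⟩
      · exact (ih _ (Or.inl hH')).2 hw
      · exact hX'.elim
  · rintro ⟨hw, ha⟩
    cases G with
    | atom a => exact Bool.false_ne_true (ha _ rfl)
    | comp ι κ L R hι hκ =>
      exact (ih _ (Or.inr ⟨hκ.some, rfl⟩)).1 (hw (ctxSum (R hκ.some) _) ⟨hκ.some, rfl⟩)

/-- The zugzwang context: whoever moves in it loses. -/
def zug (α : Type) [PartialOrder α] : Game (α →o Bool) :=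
  comp Unit Unit (fun _ => atom (cst α false)) (fun _ => atom (cst α true)) ⟨()⟩ ⟨()⟩

theorem zug_spec [PartialOrder α] : ∀ G : Game α,
    (Even G → LeftWinsSecond (ctxSum G (zug α)) ∧ ¬ LeftWinsFirst (ctxSum G (zug α))) ∧
    (Odd G → LeftWinsFirst (ctxSum G (zug α)) ∧ ¬ LeftWinsSecond (ctxSum G (zug α))) := by
  apply opt_ind
  intro G ih
  constructor
  · intro hp
    constructor
    · refine ⟨?_, ?_⟩
      · intro K hK
        rcases (right_ctxSum _ _ _).1 hK with ⟨G', hG', rfl⟩ | ⟨X', ⟨_, rfl⟩, rfl⟩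
        · exact ((ih _ (Or.inr hG')).2 (even_opt hp (Or.inr hG'))).1
        · exact (ctx_top G).1
      · intro b hb
        obtain ⟨a, f, -, h2, -⟩ := ctxSum_eq_atom _ _ _ hb
        cases h2
    · intro hw
      generalize hK : ctxSum G (zug α) = K at hw
      cases hw with
      | atom_top =>
        obtain ⟨a, f, -, h2, -⟩ := ctxSum_eq_atom _ _ _ hK
        cases h2
      | move hopt hw =>
        subst hK
        rcases (left_ctxSum _ _ _).1 hopt with ⟨H', hH', rfl⟩ | ⟨X', ⟨_, rfl⟩, rfl⟩
        · exact ((ih _ (Or.inl hH')).2 (even_opt hp (Or.inl hH'))).2 hw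
        · exact (ctx_bot G).2 hw
  · intro hp
    constructor
    · obtain ⟨G', hG'⟩ := comp_left (odd_comp hp)
      exact .move ((left_ctxSum _ _ _).2 (Or.inl ⟨_, hG', rfl⟩))
        ((ih _ (Or.inl hG')).1 (odd_opt hp (Or.inl hG'))).1
    · rintro ⟨hw, -⟩
      obtain ⟨G', hG'⟩ := comp_right (odd_comp hp)
      exact ((ih _ (Or.inr hG')).1 (odd_opt hp (Or.inr hG'))).2
        (hw _ ((right_ctxSum _ _ _).2 (Or.inl ⟨_, hG', rfl⟩)))

theorem ctxLe_imp [PartialOrder α] {G H : Game α} (h : ContextualLe G H)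
    (X : Game (α →o Bool)) :
    (LeftWinsFirst (ctxSum G X) → LeftWinsFirst (ctxSum H X)) ∧
    (LeftWinsSecond (ctxSum G X) → LeftWinsSecond (ctxSum H X)) := by
  obtain ⟨h1, h2⟩ := h X
  simp only [outcome] at h1 h2
  constructor
  · intro hw
    by_contra hn
    simp only [hw, hn, decide_true, decide_false] at h1
    exact absurd h1 (by decide)
  · intro hw
    by_contra hn
    simp only [hw, hn, decide_true, decide_false] at h2
    exact absurd h2 (by decide)

/-- For games with parity, the contextual order implies the intrinsic
order. -/
theorem contextual_implies_intrinsic {α : Type} [PartialOrder α] (G H : Game α)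
    (hGpar : HasParity G) (hHpar : HasParity H) (h : ContextualLe G H) : Le G H := by
  have hz := ctxLe_imp h (zug α)
  refine (wins_imp G H).1 ?_ ((ctxLe_imp h (rep G)).2 (wins_self G))
  rcases hGpar with hG | hG <;> rcases hHpar with hH | hH
  · exact Or.inl ⟨hG, hH⟩
  · exact absurd (hz.2 ((zug_spec G).1 hG).1) ((zug_spec H).2 hH).2
  · exact absurd (hz.1 ((zug_spec G).2 hG).1) ((zug_spec H).1 hH).2
  · exact Or.inr ⟨hG, hH⟩

end Game
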